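/- Let d ≥ 1 and let φ be an admissible weight of growth rate μ ∈ [0,1) with constant c ≥ 1. Then there exist constants C₁, C₂ > 0, depending only on d, μ and c, such that for every differentiable function u : ℝ^d → ℝ (with gradient ∇u given by its Fréchet derivative) one has C₁ · sup_{x̄ ∈ ℝ^d} φ(x̄) ∫_{ℝ^d} (|u(x)|² + |∇u(x)|²) e^{−|x−x̄|} dx ≤ sup_{z ∈ (ℤ/2)^d} φ(z) ∫_{C(z)} (|u(x)|² + |∇u(x)|²) dx ≤ C₂ · sup_{x̄ ∈ ℝ^d} φ(x̄) ∫_{ℝ^d} (|u(x)|² + |∇u(x)|²) e^{−|x−x̄|} dx (suprema taken in [0,∞]). In other words, the W^{1,2}-type uniformly bounded norm over unit cubes and its exponentially weighted counterpart are equivalent. -/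

import Mathlib

open MeasureTheory ENNReal Real

noncomputable section

/-- The closed unit cube of `ℝ^d` centered at `z`. -/
def cube (d : ℕ) (z : EuclideanSpace ℝ (Fin d)) : Set (EuclideanSpace ℝ (Fin d)) :=
  {x | ∀ i, |x i - z i| ≤ 1 / 2}

/-- The half-integer lattice point associated to `ι : Fin d → ℤ`. -/
def latticePt (d : ℕ) (ι : Fin d → ℤ) : EuclideanSpace ℝ (Fin d) :=
  WithLp.toLp 2 fun i => (ι i : ℝ) / 2


lemma measurableSet_cube {d : ℕ} (z : EuclideanSpace ℝ (Fin d)) : MeasurableSet (cube d z) := by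
  simp only [cube, Set.ofPred_forall]
  exact MeasurableSet.iInter fun i => measurableSet_le (by fun_prop) (by fun_prop)

lemma norm_sub_le_of_mem_cube {d : ℕ} {x z : EuclideanSpace ℝ (Fin d)} (hx : x ∈ cube d z) :
    ‖x - z‖ ≤ d := by
  rw [EuclideanSpace.norm_eq]
  refine Real.sqrt_le_iff.2 ⟨by positivity, ?_⟩
  calc ∑ i, ‖(x - z) i‖ ^ 2 ≤ ∑ _i : Fin d, (1 : ℝ) := by
        refine Finset.sum_le_sum fun i _ => ?_
        have h : ‖(x - z) i‖ ≤ 1 / 2 := hx i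
        nlinarith [norm_nonneg ((x - z) i)]
    _ = d := by simp
    _ ≤ (d : ℝ) ^ 2 := by exact_mod_cast Nat.le_self_pow two_ne_zero d

lemma iUnion_cube_latticePt (d : ℕ) : ⋃ ι, cube d (latticePt d ι) = Set.univ := by
  refine Set.eq_univ_of_forall fun x => Set.mem_iUnion.2 ⟨fun i => ⌊2 * x i⌋, fun i => ?_⟩
  change |x i - (⌊2 * x i⌋ : ℝ) / 2| ≤ 1 / 2
  rw [abs_le]
  constructor <;> linarith [Int.floor_le (2 * x i), Int.lt_floor_add_one (2 * x i)]

lemma tsum_pi_prod_eq_pow {α : Type*} (g : α → ℝ≥0∞) (d : ℕ) :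
    ∑' ι : Fin d → α, ∏ i, g (ι i) = (∑' n, g n) ^ d := by
  induction d with
  | zero => simp
  | succ d ih =>
    rw [← (Fin.consEquiv fun _ => α).tsum_eq, ENNReal.tsum_prod']
    simp [Fin.consEquiv, Fin.prod_univ_succ, ENNReal.tsum_mul_left, ENNReal.tsum_mul_right, ih,
      pow_succ']

lemma summable_exp_neg_mul_abs_int {a : ℝ} (ha : 0 < a) :
    Summable fun n : ℤ => Real.exp (-a * |(n : ℝ)|) := by
  have h : Summable fun n : ℕ => Real.exp (n * -a) :=
    Real.summable_exp_nat_mul_iff.2 (by linarith)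
  refine Summable.of_nat_of_neg ?_ ?_ <;> simpa [mul_comm] using h

/-- Exponential sums over the half-integer lattice are bounded uniformly in the base point. -/
lemma exists_tsum_exp_neg_latticePt_le {d : ℕ} (hd : 1 ≤ d) {b : ℝ} (hb : 0 < b) :
    ∃ K : ℝ≥0∞, K ≠ ∞ ∧ ∀ y : EuclideanSpace ℝ (Fin d),
      ∑' ι, ENNReal.ofReal (Real.exp (-b * ‖latticePt d ι - y‖)) ≤ K := by
  have hd0 : (0 : ℝ) < d := by exact_mod_cast hd
  set a : ℝ := b / d / 2 with ha_def
  have ha : 0 < a := by positivity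
  let g : ℤ → ℝ≥0∞ := fun n => ENNReal.ofReal (Real.exp a * Real.exp (-a * |(n : ℝ)|))
  have hg : ∑' n, g n ≠ ∞ :=
    ((summable_exp_neg_mul_abs_int ha).mul_left (Real.exp a)).tsum_ofReal_ne_top
  refine ⟨(∑' n, g n) ^ d, ENNReal.pow_ne_top hg, fun y => ?_⟩
  let m : Fin d → ℤ := fun i => ⌊2 * y i⌋
  rw [← tsum_pi_prod_eq_pow g d, ← (Equiv.subRight m).tsum_eq fun ι => ∏ i, g (ι i)]
  refine ENNReal.tsum_le_tsum fun ι => ?_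
  simp only [g, Equiv.subRight_apply, Pi.sub_apply]
  rw [← ENNReal.ofReal_prod_of_nonneg fun i _ => by positivity]
  refine ENNReal.ofReal_le_ofReal ?_
  simp_rw [← Real.exp_add]
  rw [← Real.exp_sum]
  refine Real.exp_le_exp.2 ?_
  have hcoord : ∀ i, -(b / d) * ‖latticePt d ι - y‖ ≤ a + -a * |((ι i - m i : ℤ) : ℝ)| := by
    intro i
    have h1 : |(ι i : ℝ) / 2 - y i| ≤ ‖latticePt d ι - y‖ :=
      PiLp.norm_apply_le (latticePt d ι - y) i
    have h2 : |((ι i - m i : ℤ) : ℝ)| ≤ 2 * |(ι i : ℝ) / 2 - y i| + 1 := by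
      have h3 := Int.floor_le (2 * y i)
      have h4 := Int.lt_floor_add_one (2 * y i)
      have h5 := abs_le.1 (le_refl |(ι i : ℝ) / 2 - y i|)
      push_cast
      rw [abs_le]
      constructor <;> simp only [m] <;> linarith
    have h6 : b / d = 2 * a := by rw [ha_def]; ring
    rw [h6]
    nlinarith
  calc -b * ‖latticePt d ι - y‖ = ∑ _i : Fin d, -(b / d) * ‖latticePt d ι - y‖ := by
        simp; field_simp
    _ ≤ _ := Finset.sum_le_sum fun i _ => hcoord i

lemma setLIntegral_cube_le {d : ℕ} (z : EuclideanSpace ℝ (Fin d))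
    {f : EuclideanSpace ℝ (Fin d) → ℝ} (hf : ∀ x, 0 ≤ f x) :
    ∫⁻ x in cube d z, ENNReal.ofReal (f x) ≤
      ENNReal.ofReal (Real.exp d) * ∫⁻ x, ENNReal.ofReal (f x * Real.exp (-‖x - z‖)) := by
  rw [← lintegral_const_mul' _ _ ENNReal.ofReal_ne_top]
  refine (setLIntegral_mono' (measurableSet_cube z) fun x hx => ?_).trans (setLIntegral_le_lintegral _ _)
  rw [← ENNReal.ofReal_mul (by positivity)]
  refine ENNReal.ofReal_le_ofReal ?_
  have h : 1 ≤ Real.exp d * Real.exp (-‖x - z‖) := by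
    rw [← Real.exp_add]
    exact Real.one_le_exp (by linarith [norm_sub_le_of_mem_cube hx])
  nlinarith [hf x]

lemma setLIntegral_cube_mul_exp_le {d : ℕ} (z y : EuclideanSpace ℝ (Fin d))
    {f : EuclideanSpace ℝ (Fin d) → ℝ} (hf : ∀ x, 0 ≤ f x) :
    ∫⁻ x in cube d z, ENNReal.ofReal (f x * Real.exp (-‖x - y‖)) ≤
      ENNReal.ofReal (Real.exp d * Real.exp (-‖z - y‖)) *
        ∫⁻ x in cube d z, ENNReal.ofReal (f x) := by
  rw [← lintegral_const_mul' _ _ ENNReal.ofReal_ne_top]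
  refine setLIntegral_mono' (measurableSet_cube z) fun x hx => ?_
  rw [← ENNReal.ofReal_mul (by positivity), mul_comm (f x)]
  refine ENNReal.ofReal_le_ofReal (mul_le_mul_of_nonneg_right ?_ (hf x))
  rw [← Real.exp_add]
  refine Real.exp_le_exp.2 ?_
  have h := norm_sub_le_norm_sub_add_norm_sub z x y
  rw [norm_sub_rev z x] at h
  linarith [norm_sub_le_of_mem_cube hx]

/-- The `W^{1,2}`-type uniformly bounded norm over unit cubes and its exponentially
weighted counterpart are equivalent, with constants depending only on `d`, `μ`, `c`. -/
theorem statement2 (d : ℕ) (hd : 1 ≤ d) (μ : ℝ) (hμ0 : 0 ≤ μ) (hμ1 : μ < 1)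
    (c : ℝ) (hc : 1 ≤ c) :
    ∃ C₁ C₂ : ℝ, 0 < C₁ ∧ 0 < C₂ ∧
      ∀ φ : EuclideanSpace ℝ (Fin d) → ℝ, Measurable φ →
        (∃ B : ℝ, ∀ x, φ x ≤ B) → (∀ x, 0 < φ x) →
        (∀ x y : EuclideanSpace ℝ (Fin d),
            c⁻¹ * Real.exp (-μ * ‖x - y‖) ≤ φ x / φ y ∧
            φ x / φ y ≤ c * Real.exp (μ * ‖x - y‖)) →
        ∀ u : EuclideanSpace ℝ (Fin d) → ℝ, Differentiable ℝ u →
          ENNReal.ofReal C₁ *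
              (⨆ xb : EuclideanSpace ℝ (Fin d), ENNReal.ofReal (φ xb) *
                ∫⁻ x, ENNReal.ofReal ((u x ^ 2 + ‖gradient u x‖ ^ 2) * Real.exp (-‖x - xb‖))) ≤
            (⨆ ι : Fin d → ℤ, ENNReal.ofReal (φ (latticePt d ι)) *
              ∫⁻ x in cube d (latticePt d ι), ENNReal.ofReal (u x ^ 2 + ‖gradient u x‖ ^ 2)) ∧
          (⨆ ι : Fin d → ℤ, ENNReal.ofReal (φ (latticePt d ι)) *
              ∫⁻ x in cube d (latticePt d ι), ENNReal.ofReal (u x ^ 2 + ‖gradient u x‖ ^ 2)) ≤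
            ENNReal.ofReal C₂ *
              (⨆ xb : EuclideanSpace ℝ (Fin d), ENNReal.ofReal (φ xb) *
                ∫⁻ x, ENNReal.ofReal ((u x ^ 2 + ‖gradient u x‖ ^ 2) * Real.exp (-‖x - xb‖))) := by
  obtain ⟨K, hK, hsum⟩ := exists_tsum_exp_neg_latticePt_le hd (sub_pos.2 hμ1)
  set A : ℝ := c * Real.exp d * (K.toReal + 1) with hA_def
  have hc0 : 0 < c := by linarith
  have hA : 0 < A := by positivity
  refine ⟨A⁻¹, Real.exp d, by positivity, by positivity, ?_⟩
  intro φ _ _ hφ hadm u _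
  have hf : ∀ x, 0 ≤ u x ^ 2 + ‖gradient u x‖ ^ 2 := fun x => by positivity
  set f := fun x => u x ^ 2 + ‖gradient u x‖ ^ 2
  set S := ⨆ ι : Fin d → ℤ, ENNReal.ofReal (φ (latticePt d ι)) *
    ∫⁻ x in cube d (latticePt d ι), ENNReal.ofReal (f x)
  constructor
  · rw [ENNReal.ofReal_inv_of_pos hA]
    refine ENNReal.inv_mul_le_iff (by simpa using hA) ENNReal.ofReal_ne_top |>.2 ?_
    refine iSup_le fun y => ?_
    have hterm : ∀ ι, ENNReal.ofReal (φ y) *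
        ∫⁻ x in cube d (latticePt d ι), ENNReal.ofReal (f x * Real.exp (-‖x - y‖)) ≤
        ENNReal.ofReal (c * Real.exp d) *
          ENNReal.ofReal (Real.exp (-(1 - μ) * ‖latticePt d ι - y‖)) * S := by
      intro ι
      set z := latticePt d ι
      have hφy : φ y * (Real.exp d * Real.exp (-‖z - y‖)) ≤
          c * Real.exp d * Real.exp (-(1 - μ) * ‖z - y‖) * φ z := by
        have h := (div_le_iff₀ (hφ z)).1 (hadm y z).2
        rw [norm_sub_rev y z] at h
        have hexp : Real.exp (-(1 - μ) * ‖z - y‖) =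
            Real.exp (μ * ‖z - y‖) * Real.exp (-‖z - y‖) := by
          rw [← Real.exp_add]; ring_nf
        rw [hexp]
        calc _ ≤ c * Real.exp (μ * ‖z - y‖) * φ z * (Real.exp d * Real.exp (-‖z - y‖)) := by
              gcongr
          _ = _ := by ring
      calc _ ≤ ENNReal.ofReal (φ y) * (ENNReal.ofReal (Real.exp d * Real.exp (-‖z - y‖)) *
            ∫⁻ x in cube d z, ENNReal.ofReal (f x)) := by
            gcongr; exact setLIntegral_cube_mul_exp_le z y hf
        _ = ENNReal.ofReal (φ y * (Real.exp d * Real.exp (-‖z - y‖))) *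
            ∫⁻ x in cube d z, ENNReal.ofReal (f x) := by
            rw [ENNReal.ofReal_mul (hφ y).le, mul_assoc]
        _ ≤ ENNReal.ofReal (c * Real.exp d * Real.exp (-(1 - μ) * ‖z - y‖) * φ z) *
            ∫⁻ x in cube d z, ENNReal.ofReal (f x) := by gcongr
        _ = ENNReal.ofReal (c * Real.exp d) * ENNReal.ofReal (Real.exp (-(1 - μ) * ‖z - y‖)) *
            (ENNReal.ofReal (φ z) * ∫⁻ x in cube d z, ENNReal.ofReal (f x)) := by
            rw [ENNReal.ofReal_mul (by positivity), ENNReal.ofReal_mul (by positivity), mul_assoc]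
        _ ≤ _ := by
            gcongr
            exact le_iSup (fun ι : Fin d → ℤ => ENNReal.ofReal (φ (latticePt d ι)) *
              ∫⁻ x in cube d (latticePt d ι), ENNReal.ofReal (f x)) ι
    calc _ ≤ ENNReal.ofReal (φ y) * ∑' ι, ∫⁻ x in cube d (latticePt d ι),
            ENNReal.ofReal (f x * Real.exp (-‖x - y‖)) := by
          gcongr
          rw [← setLIntegral_univ, ← iUnion_cube_latticePt d]
          exact lintegral_iUnion_le _ _
      _ ≤ ∑' ι, ENNReal.ofReal (c * Real.exp d) *
          ENNReal.ofReal (Real.exp (-(1 - μ) * ‖latticePt d ι - y‖)) * S := by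
          rw [← ENNReal.tsum_mul_left]
          exact ENNReal.tsum_le_tsum hterm
      _ ≤ ENNReal.ofReal (c * Real.exp d) * K * S := by
          rw [ENNReal.tsum_mul_right, ENNReal.tsum_mul_left]
          gcongr
          exact hsum y
      _ ≤ ENNReal.ofReal A * S := by
          rw [hA_def, ENNReal.ofReal_mul (p := c * Real.exp d) (by positivity)]
          gcongr
          rw [ENNReal.le_ofReal_iff_toReal_le hK (by positivity)]
          linarith
  · refine iSup_le fun ι => ?_
    calc _ ≤ ENNReal.ofReal (φ (latticePt d ι)) * (ENNReal.ofReal (Real.exp d) *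
          ∫⁻ x, ENNReal.ofReal (f x * Real.exp (-‖x - latticePt d ι‖))) := by
          gcongr; exact setLIntegral_cube_le _ hf
      _ = ENNReal.ofReal (Real.exp d) * (ENNReal.ofReal (φ (latticePt d ι)) *
          ∫⁻ x, ENNReal.ofReal (f x * Real.exp (-‖x - latticePt d ι‖))) := by ring
      _ ≤ _ := by
          gcongr
          exact le_iSup (fun y => ENNReal.ofReal (φ y) *
            ∫⁻ x, ENNReal.ofReal (f x * Real.exp (-‖x - y‖))) (latticePt d ι)
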